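/- For every m ≥ 0 and every n ≥ 1, the mutual information per variable satisfies I(x*;Y)/n ≤ i_B(m) + (2·E_p[X⁴] − (E_p[X²])²)/(4nΔ). In particular, limsup_{n→∞} I(x*;Y)/n ≤ i_B(m) for every m ≥ 0. -/

import Mathlib

open MeasureTheory ProbabilityTheory Filter Real

noncomputable section

/-- Index set of pairs `1 ≤ i ≤ j ≤ n`. -/
abbrev SymIdx (n : ℕ) := {q : Fin n × Fin n // q.1 ≤ q.2}

/-- Kullback–Leibler divergence, expressed as the integral of the log-likelihood ratio. -/
def klDivR {α : Type*} [MeasurableSpace α] (μ ν : Measure α) : ℝ := ∫ a, llr μ ν a ∂μ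

/-- Mutual information of a joint law on a product space: the KL divergence between the
joint law and the product of its marginals. -/
def mutualInfoR {α β : Type*} [MeasurableSpace α] [MeasurableSpace β]
    (μ : Measure (α × β)) : ℝ := klDivR μ (μ.fst.prod μ.snd)

/-- Joint law of `(x*, Y)` for the Gaussian channel `Y_{ij} = x*_i x*_j/√n + √Δ ξ_{ij}`,
where `x*` has i.i.d. coordinates of law `p` and `ξ` is i.i.d. standard Gaussian. -/
def gaussJoint (p : Measure ℝ) (Δ : ℝ) (n : ℕ) :
    Measure ((Fin n → ℝ) × (SymIdx n → ℝ)) :=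
  ((Measure.pi fun _ : Fin n => p).prod
      (Measure.pi fun _ : SymIdx n => gaussianReal 0 1)).map
    (fun w => (w.1, fun q : SymIdx n =>
      w.1 q.1.1 * w.1 q.1.2 / Real.sqrt n + Real.sqrt Δ * w.2 q))

/-- The mutual information `I(x*; Y)` for the Gaussian channel. -/
def MI (p : Measure ℝ) (Δ : ℝ) (n : ℕ) : ℝ := mutualInfoR (gaussJoint p Δ n)

/-- `J(A,B) = log ∫ exp(Bx - A x²/2) p(dx)`. -/
def Jf (p : Measure ℝ) (A B : ℝ) : ℝ := Real.log (∫ x, Real.exp (B * x - A * x ^ 2 / 2) ∂p)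

/-- The Bethe mutual information `i_B(m)`. -/
def iB (p : Measure ℝ) (Δ m : ℝ) : ℝ :=
  (m ^ 2 + (∫ x, x ^ 2 ∂p) ^ 2) / (4 * Δ)
    - ∫ w : ℝ × ℝ, Jf p (m / Δ) (m * w.1 / Δ + Real.sqrt (m / Δ) * w.2)
        ∂(p.prod (gaussianReal 0 1))

section GaussianTools

variable {ι : Type*} [Fintype ι]

/-- The standard Gaussian measure on `ι → ℝ`. -/
abbrev stdGauss (ι : Type*) [Fintype ι] : Measure (ι → ℝ) :=
  Measure.pi fun _ : ι => gaussianReal 0 1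

/-- The density of the standard Gaussian translated by `u` with respect to the standard Gaussian. -/
def tilt (u y : ι → ℝ) : ℝ := exp (∑ k, (u k * y k - u k ^ 2 / 2))

/-- A weight `1 + ‖y‖₁`, used to express growth conditions. -/
def wt (y : ι → ℝ) : ℝ := 1 + ∑ k, |y k|

lemma one_le_wt (y : ι → ℝ) : 1 ≤ wt y := by
  have : 0 ≤ ∑ k, |y k| := Finset.sum_nonneg fun _ _ => abs_nonneg _
  unfold wt; linarith

lemma abs_le_wt (y : ι → ℝ) (k : ι) : |y k| ≤ wt y := by
  have := Finset.single_le_sum (f := fun k => |y k|) (fun i _ => abs_nonneg _) (Finset.mem_univ k)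
  unfold wt; linarith

@[fun_prop]
lemma continuous_tilt (u : ι → ℝ) : Continuous (tilt u) := by unfold tilt; fun_prop

@[fun_prop]
lemma continuous_wt : Continuous (wt : (ι → ℝ) → ℝ) := by unfold wt; fun_prop

lemma tilt_pos (u y : ι → ℝ) : 0 < tilt u y := exp_pos _

lemma integrable_exp_abs_gaussianReal (C : ℝ) :
    Integrable (fun t => exp (C * |t|)) (gaussianReal 0 1) :=
  integrable_exp_mul_abs (integrable_exp_mul_gaussianReal C) (integrable_exp_mul_gaussianReal (-C))

lemma integrable_exp_wt (C : ℝ) : Integrable (fun y : ι → ℝ => exp (C * wt y)) (stdGauss ι) := by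
  have h := (Integrable.fintype_prod (μ := fun _ : ι => gaussianReal 0 1)
    (f := fun _ t => exp (C * |t|)) fun _ => integrable_exp_abs_gaussianReal C).const_mul (exp C)
  refine h.congr (ae_of_all _ fun y => ?_)
  simp only [wt]
  rw [← exp_sum, ← exp_add, ← Finset.mul_sum]
  ring_nf

/-- Continuous functions of at most exponential growth are Gaussian-integrable. -/
lemma integrable_of_le_exp {f : (ι → ℝ) → ℝ} (hf : Continuous f) {K C : ℝ}
    (h : ∀ y, |f y| ≤ K * wt y ^ 3 * exp (C * wt y)) : Integrable f (stdGauss ι) := by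
  refine ((integrable_exp_wt (ι := ι) (C + 3)).const_mul |K|).mono' hf.aestronglyMeasurable
    (ae_of_all _ fun y => (h y).trans ?_)
  have h1 := one_le_wt y
  have h2 : wt y ≤ exp (wt y) := by linarith [add_one_le_exp (wt y)]
  have h3 : wt y ^ 3 ≤ exp (3 * wt y) := by
    calc wt y ^ 3 ≤ exp (wt y) ^ 3 := by gcongr
      _ = _ := by rw [← exp_nat_mul]; norm_num
  calc K * wt y ^ 3 * exp (C * wt y) ≤ |K| * exp (3 * wt y) * exp (C * wt y) := by
        gcongr; exact le_abs_self K
    _ = _ := by rw [mul_assoc, ← exp_add]; ring_nf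

/-- **Stein's lemma** on the real line. -/
lemma stein_real {g g' : ℝ → ℝ} (hg : ∀ t, HasDerivAt g (g' t) t)
    (h1 : Integrable g (gaussianReal 0 1)) (h2 : Integrable (fun t => t * g t) (gaussianReal 0 1))
    (h3 : Integrable g' (gaussianReal 0 1)) :
    ∫ t, t * g t ∂(gaussianReal 0 1) = ∫ t, g' t ∂(gaussianReal 0 1) := by
  have key : ∀ f : ℝ → ℝ, Integrable f (gaussianReal 0 1) →
      Integrable (fun t => gaussianPDFReal 0 1 t * f t) := by
    intro f hf
    rw [gaussianReal_of_var_ne_zero _ one_ne_zero] at hf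
    rw [integrable_withDensity_iff_integrable_smul₀' (by fun_prop)
      (ae_of_all _ fun _ => gaussianPDF_lt_top)] at hf
    simpa [toReal_gaussianPDF] using hf
  have hφ : ∀ t, HasDerivAt (gaussianPDFReal 0 1) (-t * gaussianPDFReal 0 1 t) t := by
    intro t
    have : HasDerivAt (fun t : ℝ => -(t - 0) ^ 2 / (2 * ((1 : NNReal) : ℝ))) (-t) t := by
      have := (((hasDerivAt_id t).sub_const 0).pow 2).neg.div_const (2 * ((1 : NNReal) : ℝ))
      refine this.congr_deriv ?_
      simp
      ring
    have h := (this.exp).const_mul (√(2 * π * (1 : NNReal)))⁻¹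
    refine h.congr_deriv ?_
    simp only [gaussianPDFReal]
    ring
  simp only [integral_gaussianReal_eq_integral_smul one_ne_zero, smul_eq_mul]
  have := integral_mul_deriv_eq_deriv_mul_of_integrable (u := g) (v := gaussianPDFReal 0 1)
    (u' := g') (v' := fun t => -t * gaussianPDFReal 0 1 t) (fun t _ => hg t) (fun t _ => hφ t)
    ((key _ h2).neg.congr (ae_of_all _ fun t => by simp; ring))
    ((key _ h3).congr (ae_of_all _ fun t => by simp; ring))
    ((key _ h1).congr (ae_of_all _ fun t => by simp; ring))
  rw [← neg_inj, ← integral_neg, ← integral_neg]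
  calc _ = ∫ x, g x * (-x * gaussianPDFReal 0 1 x) := by congr 1; ext; ring
    _ = _ := by rw [this, ← integral_neg]; congr 1; ext; ring

variable [DecidableEq ι]

/-- Resampling one coordinate preserves the standard Gaussian measure. -/
lemma measurePreserving_update (k : ι) :
    MeasurePreserving (fun w : (ι → ℝ) × ℝ => Function.update w.1 k w.2)
      ((stdGauss ι).prod (gaussianReal 0 1)) (stdGauss ι) := by
  have hm : Measurable (fun w : (ι → ℝ) × ℝ => Function.update w.1 k w.2) := by
    refine measurable_pi_lambda _ fun i => ?_
    by_cases h : i = k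
    · subst h; simpa using measurable_snd
    · simp only [Function.update_of_ne h]; fun_prop
  refine ⟨hm, (Measure.pi_eq fun s hs => ?_).symm⟩
  rw [Measure.map_apply hm (MeasurableSet.univ_pi hs)]
  have : (fun w : (ι → ℝ) × ℝ => Function.update w.1 k w.2) ⁻¹' Set.univ.pi s
      = (Set.univ.pi (Function.update s k Set.univ)) ×ˢ s k := by
    ext ⟨y, t⟩
    simp only [Set.mem_preimage, Set.mem_pi, Set.mem_univ, true_imp_iff, Set.mem_prod]
    constructor
    · intro h
      refine ⟨fun i => ?_, by simpa using h k⟩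
      by_cases hi : i = k
      · subst hi; simp
      · simpa [hi] using h i
    · rintro ⟨h, ht⟩ i
      by_cases hi : i = k
      · subst hi; simpa
      · simpa [hi] using h i
  rw [this, Measure.prod_prod, Measure.pi_pi, ← Finset.prod_erase_mul _ _ (Finset.mem_univ k),
    ← Finset.prod_erase_mul (Finset.univ) (fun i => (gaussianReal 0 1) (s i)) (Finset.mem_univ k)]
  simp only [Function.update_self, measure_univ, mul_one]
  congr 1
  refine Finset.prod_congr rfl fun i hi => ?_
  rw [Function.update_of_ne (Finset.ne_of_mem_erase hi)]

/-- **Stein's lemma** for the standard Gaussian measure on `ι → ℝ`, in coordinate `k`. -/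
lemma stein_pi (k : ι) {G G' : (ι → ℝ) → ℝ}
    (hG : ∀ y, HasDerivAt (fun t => G (Function.update y k t)) (G' y) (y k))
    (h1 : Integrable G (stdGauss ι)) (h2 : Integrable (fun y => y k * G y) (stdGauss ι))
    (h3 : Integrable G' (stdGauss ι)) :
    ∫ y, y k * G y ∂(stdGauss ι) = ∫ y, G' y ∂(stdGauss ι) := by
  have mp := measurePreserving_update k
  have i1 := mp.integrable_comp_of_integrable h1
  have i2 := mp.integrable_comp_of_integrable h2
  have i3 := mp.integrable_comp_of_integrable h3
  have e : ∀ f : (ι → ℝ) → ℝ, Integrable f (stdGauss ι) → ∫ y, f y ∂(stdGauss ι)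
      = ∫ y, ∫ t, f (Function.update y k t) ∂(gaussianReal 0 1) ∂(stdGauss ι) := by
    intro f hf
    have h := integral_map mp.aemeasurable (f := f) (by rw [mp.map_eq]; exact hf.1)
    rw [mp.map_eq] at h
    exact h.trans (integral_prod _ (mp.integrable_comp_of_integrable hf))
  rw [e _ h2, e _ h3]
  refine integral_congr_ae ?_
  filter_upwards [i1.prod_right_ae, i2.prod_right_ae, i3.prod_right_ae] with y j1 j2 j3
  simp only [Function.comp_def, Function.update_self] at j1 j2 j3 ⊢
  refine stein_real (fun t => ?_) j1 j2 j3
  simpa using hG (Function.update y k t)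

end GaussianTools

section Mixture

variable {ι : Type*} [Fintype ι] {Ω : Type*} [Fintype Ω]

/-- The density of a mixture of translated standard Gaussians with weights `w` and centres `S`. -/
def mix (w : Ω → ℝ) (S : Ω → ι → ℝ) (y : ι → ℝ) : ℝ := ∑ σ, w σ * tilt (S σ) y

@[fun_prop]
lemma continuous_mix (w : Ω → ℝ) (S : Ω → ι → ℝ) : Continuous (mix w S) := by
  unfold mix; fun_prop

/-- Exponential growth rate of the densities with centres bounded by `A`. -/
def rate (ι : Type*) [Fintype ι] (A : ℝ) : ℝ := A + Fintype.card ι * A ^ 2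

lemma abs_exponent_le {A : ℝ} (hA : 0 ≤ A) {u : ι → ℝ} (hu : ∀ k, |u k| ≤ A) (y : ι → ℝ) :
    |∑ k, (u k * y k - u k ^ 2 / 2)| ≤ rate ι A * wt y := by
  have h1 : ∀ k, |u k * y k - u k ^ 2 / 2| ≤ A * |y k| + A ^ 2 := by
    intro k
    have h2 : u k ^ 2 ≤ A ^ 2 := sq_le_sq' (abs_le.1 (hu k)).1 (abs_le.1 (hu k)).2
    calc |u k * y k - u k ^ 2 / 2| ≤ |u k * y k| + |u k ^ 2 / 2| := abs_sub _ _
      _ ≤ A * |y k| + A ^ 2 := by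
        rw [abs_mul, abs_of_nonneg (by positivity : 0 ≤ u k ^ 2 / 2)]
        have := mul_le_mul_of_nonneg_right (hu k) (abs_nonneg (y k))
        nlinarith [sq_nonneg (u k)]
  refine (Finset.abs_sum_le_sum_abs _ _).trans ((Finset.sum_le_sum fun k _ => h1 k).trans ?_)
  rw [Finset.sum_add_distrib, ← Finset.mul_sum]
  have h3 := one_le_wt y
  have h4 : ∑ k, |y k| ≤ wt y := by unfold wt; linarith
  simp only [Finset.sum_const, Finset.card_univ, nsmul_eq_mul]
  have h5 : 0 ≤ (Fintype.card ι : ℝ) * A ^ 2 := by positivity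
  unfold rate
  nlinarith [mul_le_mul_of_nonneg_left h4 hA]

lemma tilt_le {A : ℝ} (hA : 0 ≤ A) {u : ι → ℝ} (hu : ∀ k, |u k| ≤ A) (y : ι → ℝ) :
    tilt u y ≤ exp (rate ι A * wt y) :=
  exp_le_exp.2 (abs_le.1 (abs_exponent_le hA hu y)).2

lemma le_tilt {A : ℝ} (hA : 0 ≤ A) {u : ι → ℝ} (hu : ∀ k, |u k| ≤ A) (y : ι → ℝ) :
    exp (-(rate ι A * wt y)) ≤ tilt u y :=
  exp_le_exp.2 (abs_le.1 (abs_exponent_le hA hu y)).1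

lemma rate_nonneg {A : ℝ} (hA : 0 ≤ A) : 0 ≤ rate ι A := by unfold rate; positivity

/-- Weighted averages of bounded quantities are bounded by the mixture density. -/
lemma abs_sum_mul_tilt_le {w : Ω → ℝ} (hw : ∀ σ, 0 ≤ w σ) {A : ℝ} {c : Ω → ℝ}
    (hc : ∀ σ, |c σ| ≤ A) (S : Ω → ι → ℝ) (y : ι → ℝ) :
    |∑ σ, w σ * c σ * tilt (S σ) y| ≤ A * mix w S y := by
  refine (Finset.abs_sum_le_sum_abs _ _).trans ?_
  rw [mix, Finset.mul_sum]
  refine Finset.sum_le_sum fun σ _ => ?_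
  rw [abs_mul, abs_mul, abs_of_nonneg (hw σ), abs_of_pos (tilt_pos _ _)]
  have := mul_le_mul_of_nonneg_right (hc σ) (mul_nonneg (hw σ) (tilt_pos (S σ) y).le)
  linarith

lemma exists_abs_le (u : Ω → ι → ℝ) : ∃ A, 0 ≤ A ∧ ∀ σ k, |u σ k| ≤ A := by
  refine ⟨∑ σ, ∑ k, |u σ k|, by positivity, fun σ k => ?_⟩
  refine (Finset.single_le_sum (f := fun k => |u σ k|) (fun i _ => abs_nonneg _)
    (Finset.mem_univ k)).trans ?_
  exact Finset.single_le_sum (f := fun σ => ∑ k, |u σ k|)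
    (fun i _ => Finset.sum_nonneg fun _ _ => abs_nonneg _) (Finset.mem_univ σ)

section Weights

variable {w : Ω → ℝ} {A : ℝ} {S : Ω → ι → ℝ}

lemma integrable_tilt (u : ι → ℝ) : Integrable (tilt u) (stdGauss ι) := by
  have hu : ∀ k, |u k| ≤ ∑ j, |u j| := fun k =>
    Finset.single_le_sum (f := fun k => |u k|) (fun i _ => abs_nonneg _) (Finset.mem_univ k)
  have h0 : 0 ≤ ∑ j, |u j| := Finset.sum_nonneg fun _ _ => abs_nonneg _
  refine (integrable_exp_wt (rate ι (∑ j, |u j|))).mono' (by fun_prop) (ae_of_all _ fun y => ?_)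
  rw [Real.norm_of_nonneg (tilt_pos _ _).le]
  exact tilt_le h0 hu y

lemma mix_pos (hw : ∀ σ, 0 ≤ w σ) (hw1 : ∑ σ, w σ = 1)
    (S : Ω → ι → ℝ) (y : ι → ℝ) : 0 < mix w S y := by
  obtain ⟨σ, -, hσ⟩ := Finset.exists_ne_zero_of_sum_ne_zero (hw1 ▸ one_ne_zero)
  exact Finset.sum_pos' (fun σ _ => mul_nonneg (hw σ) (tilt_pos _ _).le)
    ⟨σ, Finset.mem_univ _, mul_pos (lt_of_le_of_ne (hw σ) (Ne.symm hσ)) (tilt_pos _ _)⟩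

@[fun_prop]
lemma continuous_log_mix (hw : ∀ σ, 0 ≤ w σ) (hw1 : ∑ σ, w σ = 1)
    (S : Ω → ι → ℝ) : Continuous (fun y => log (mix w S y)) :=
  (continuous_mix w S).log fun y => (mix_pos hw hw1 S y).ne'

lemma mix_le (hw : ∀ σ, 0 ≤ w σ) (hw1 : ∑ σ, w σ = 1) (hA : 0 ≤ A)
    (hS : ∀ σ k, |S σ k| ≤ A) (y : ι → ℝ) : mix w S y ≤ exp (rate ι A * wt y) := by
  calc mix w S y ≤ ∑ σ, w σ * exp (rate ι A * wt y) :=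
        Finset.sum_le_sum fun σ _ => mul_le_mul_of_nonneg_left (tilt_le hA (hS σ) y) (hw σ)
    _ = _ := by rw [← Finset.sum_mul, hw1, one_mul]

lemma le_mix (hw : ∀ σ, 0 ≤ w σ) (hw1 : ∑ σ, w σ = 1) (hA : 0 ≤ A)
    (hS : ∀ σ k, |S σ k| ≤ A) (y : ι → ℝ) : exp (-(rate ι A * wt y)) ≤ mix w S y := by
  calc exp (-(rate ι A * wt y)) = ∑ σ, w σ * exp (-(rate ι A * wt y)) := by
        rw [← Finset.sum_mul, hw1, one_mul]
    _ ≤ mix w S y :=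
        Finset.sum_le_sum fun σ _ => mul_le_mul_of_nonneg_left (le_tilt hA (hS σ) y) (hw σ)

lemma abs_log_mix_le (hw : ∀ σ, 0 ≤ w σ) (hw1 : ∑ σ, w σ = 1) (hA : 0 ≤ A)
    (hS : ∀ σ k, |S σ k| ≤ A) (y : ι → ℝ) : |log (mix w S y)| ≤ rate ι A * wt y := by
  have h := mix_pos hw hw1 S y
  rw [abs_le]
  exact ⟨(le_log_iff_exp_le h).2 (le_mix hw hw1 hA hS y),
    (log_le_iff_le_exp h).2 (mix_le hw hw1 hA hS y)⟩

lemma abs_one_add_log_mix_le (hw : ∀ σ, 0 ≤ w σ) (hw1 : ∑ σ, w σ = 1) (hA : 0 ≤ A)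
    (hS : ∀ σ k, |S σ k| ≤ A) (y : ι → ℝ) :
    |1 + log (mix w S y)| ≤ (1 + rate ι A) * wt y := by
  have h := abs_log_mix_le hw hw1 hA hS y
  have := abs_add_le 1 (log (mix w S y))
  have := one_le_wt y
  rw [abs_one] at *
  linarith

lemma integrable_tilt_mul_log_mix (hw : ∀ σ, 0 ≤ w σ) (hw1 : ∑ σ, w σ = 1) (hA : 0 ≤ A)
    (hS : ∀ σ k, |S σ k| ≤ A) {u : ι → ℝ} (hu : ∀ k, |u k| ≤ A) :
    Integrable (fun y => tilt u y * log (mix w S y)) (stdGauss ι) := by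
  refine integrable_of_le_exp (K := rate ι A) (C := rate ι A)
    ((continuous_tilt u).mul (continuous_log_mix hw hw1 S)) fun y => ?_
  have h1 := one_le_wt y
  have h2 := rate_nonneg (ι := ι) hA
  rw [abs_mul, abs_of_pos (tilt_pos _ y), mul_comm]
  have h3 : wt y ≤ wt y ^ 3 := le_self_pow₀ h1 (by norm_num)
  refine mul_le_mul ((abs_log_mix_le hw hw1 hA hS y).trans ?_) (tilt_le hA hu y)
    (tilt_pos _ y).le (by positivity)
  gcongr

lemma integrable_mix_mul_log (hw : ∀ σ, 0 ≤ w σ) (hw1 : ∑ σ, w σ = 1) (hA : 0 ≤ A)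
    (hS : ∀ σ k, |S σ k| ≤ A) :
    Integrable (fun y => mix w S y * log (mix w S y)) (stdGauss ι) := by
  have h : Integrable (fun y => ∑ σ, w σ * (tilt (S σ) y * log (mix w S y))) (stdGauss ι) :=
    integrable_finsetSum _ fun σ _ =>
      (integrable_tilt_mul_log_mix hw hw1 hA hS (hS σ)).const_mul _
  refine h.congr (ae_of_all _ fun y => ?_)
  simp only [mix, Finset.sum_mul, mul_assoc]

end Weights

lemma hasDerivAt_tilt_center {u : ℝ → ι → ℝ} {u' : ι → ℝ} {θ : ℝ}
    (hu : ∀ k, HasDerivAt (fun θ => u θ k) (u' k) θ) (y : ι → ℝ) :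
    HasDerivAt (fun θ => tilt (u θ) y) ((∑ k, u' k * (y k - u θ k)) * tilt (u θ) y) θ := by
  have h : HasDerivAt (fun θ => ∑ k, (u θ k * y k - u θ k ^ 2 / 2))
      (∑ k, u' k * (y k - u θ k)) θ := by
    refine HasDerivAt.fun_sum fun k _ => ?_
    refine (((hu k).mul_const (y k)).sub (((hu k).pow 2).div_const 2)).congr_deriv ?_
    simp
    ring
  exact h.exp.congr_deriv (mul_comm _ _)

lemma hasDerivAt_tilt_update [DecidableEq ι] (u y : ι → ℝ) (k : ι) :
    HasDerivAt (fun t => tilt u (Function.update y k t)) (u k * tilt u y) (y k) := by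
  have h : HasDerivAt (fun t => ∑ j, (u j * Function.update y k t j - u j ^ 2 / 2))
      (∑ j, if j = k then u k else 0) (y k) := by
    refine HasDerivAt.fun_sum fun j _ => ?_
    by_cases hj : j = k
    · subst hj
      simpa using ((hasDerivAt_id (y j)).const_mul (u j)).sub_const (u j ^ 2 / 2)
    · simpa [hj] using hasDerivAt_const (y k) (u j * y j)
  refine h.exp.congr_deriv ?_
  simp [tilt, mul_comm]

lemma hasDerivAt_mix_update [DecidableEq ι] (w : Ω → ℝ) (S : Ω → ι → ℝ) (y : ι → ℝ) (k : ι) :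
    HasDerivAt (fun t => mix w S (Function.update y k t))
      (∑ σ, w σ * S σ k * tilt (S σ) y) (y k) := by
  refine (HasDerivAt.fun_sum fun σ _ =>
    (hasDerivAt_tilt_update (S σ) y k).const_mul (w σ)).congr_deriv ?_
  simp only [mul_assoc]

/-- Integration by parts for the logarithm of a Gaussian mixture. -/
lemma integral_sub_mul_log_mix {w : Ω → ℝ} (hw : ∀ σ, 0 ≤ w σ) (hw1 : ∑ σ, w σ = 1) {A : ℝ}
    (hA : 0 ≤ A) {S : Ω → ι → ℝ} (hS : ∀ σ k, |S σ k| ≤ A) {u : ι → ℝ} (hu : ∀ k, |u k| ≤ A)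
    (k : ι) :
    Integrable (fun y => (y k - u k) * ((1 + log (mix w S y)) * tilt u y)) (stdGauss ι) ∧
    Integrable (fun y => tilt u y * ((∑ σ, w σ * S σ k * tilt (S σ) y) / mix w S y))
      (stdGauss ι) ∧
    ∫ y, (y k - u k) * ((1 + log (mix w S y)) * tilt u y) ∂(stdGauss ι)
      = ∫ y, tilt u y * ((∑ σ, w σ * S σ k * tilt (S σ) y) / mix w S y) ∂(stdGauss ι) := by
  classical
  have hpos := mix_pos hw hw1 S
  have hC := rate_nonneg (ι := ι) hA
  have hc : Continuous (fun y => (1 + log (mix w S y)) * tilt u y) :=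
    (continuous_const.add (continuous_log_mix hw hw1 S)).mul (continuous_tilt u)
  have hb : ∀ y, |(1 + log (mix w S y)) * tilt u y|
      ≤ (1 + rate ι A) * wt y * exp (rate ι A * wt y) := fun y => by
    have := one_le_wt y
    rw [abs_mul, abs_of_pos (tilt_pos _ _)]
    exact mul_le_mul (abs_one_add_log_mix_le hw hw1 hA hS y) (tilt_le hA hu y) (tilt_pos _ _).le
      (by positivity)
  have i1 : Integrable (fun y => (1 + log (mix w S y)) * tilt u y) (stdGauss ι) := by
    refine integrable_of_le_exp (K := 1 + rate ι A) (C := rate ι A) hc fun y => (hb y).trans ?_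
    have h1 := one_le_wt y
    have h3 : wt y ≤ wt y ^ 3 := le_self_pow₀ h1 (by norm_num)
    gcongr
  have i2 : Integrable (fun y => y k * ((1 + log (mix w S y)) * tilt u y)) (stdGauss ι) := by
    refine integrable_of_le_exp (K := 1 + rate ι A) (C := rate ι A)
      ((continuous_apply k).mul hc) fun y => ?_
    have h1 := one_le_wt y
    rw [abs_mul]
    have h3 : wt y ^ 2 ≤ wt y ^ 3 := pow_le_pow_right₀ h1 (by norm_num)
    calc |y k| * |(1 + log (mix w S y)) * tilt u y|
        ≤ wt y * ((1 + rate ι A) * wt y * exp (rate ι A * wt y)) :=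
          mul_le_mul (abs_le_wt y k) (hb y) (abs_nonneg _) (by positivity)
      _ = (1 + rate ι A) * wt y ^ 2 * exp (rate ι A * wt y) := by ring
      _ ≤ _ := by gcongr
  have i3 : Integrable (fun y => tilt u y * ((∑ σ, w σ * S σ k * tilt (S σ) y) / mix w S y))
      (stdGauss ι) := by
    refine ((integrable_tilt u).mul_const A).mono' ?_ (ae_of_all _ fun y => ?_)
    · refine Continuous.aestronglyMeasurable ((continuous_tilt u).mul (Continuous.div ?_
        (continuous_mix w S) fun y => (hpos y).ne'))
      fun_prop
    · rw [norm_mul, Real.norm_of_nonneg (tilt_pos u y).le, norm_div,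
        Real.norm_of_nonneg (hpos y).le, Real.norm_eq_abs]
      refine mul_le_mul_of_nonneg_left ?_ (tilt_pos u y).le
      rw [div_le_iff₀ (hpos y)]
      exact abs_sum_mul_tilt_le hw (hS · k) S y
  have hd : ∀ y, HasDerivAt (fun t => (1 + log (mix w S (Function.update y k t)))
        * tilt u (Function.update y k t))
      (u k * ((1 + log (mix w S y)) * tilt u y)
        + tilt u y * ((∑ σ, w σ * S σ k * tilt (S σ) y) / mix w S y)) (y k) := by
    intro y
    have h1 := ((hasDerivAt_mix_update w S y k).log (by simpa using (hpos y).ne')).const_add 1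
    refine (h1.mul (hasDerivAt_tilt_update u y k)).congr_deriv ?_
    simp
    ring
  have st := stein_pi k hd i1 i2 ((i1.const_mul (u k)).fun_add i3)
  have e : (fun y => (y k - u k) * ((1 + log (mix w S y)) * tilt u y))
      = fun y => y k * ((1 + log (mix w S y)) * tilt u y)
        - u k * ((1 + log (mix w S y)) * tilt u y) := by ext; ring
  refine ⟨e ▸ i2.sub (i1.const_mul _), i3, ?_⟩
  rw [e, integral_sub i2 (i1.const_mul _), st, integral_add (i1.const_mul _) i3]
  ring

/-- Derivative of the entropy of a Gaussian mixture along a smooth path of centres. -/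
theorem hasDerivAt_integral_mix_mul_log {w : Ω → ℝ} (hw : ∀ σ, 0 ≤ w σ) (hw1 : ∑ σ, w σ = 1)
    {A : ℝ} (hA : 0 ≤ A) {S S' : ℝ → Ω → ι → ℝ} (hS : ∀ θ σ k, |S θ σ k| ≤ A)
    (hS' : ∀ θ σ k, |S' θ σ k| ≤ A)
    (hd : ∀ θ σ k, HasDerivAt (fun θ => S θ σ k) (S' θ σ k) θ) (θ : ℝ) :
    HasDerivAt (fun θ => ∫ y, mix w (S θ) y * log (mix w (S θ) y) ∂(stdGauss ι))
      (∫ y, ∑ k, (∑ σ, w σ * S' θ σ k * tilt (S θ σ) y) * (∑ σ, w σ * S θ σ k * tilt (S θ σ) y)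
        / mix w (S θ) y ∂(stdGauss ι)) θ := by
  have hpos := fun θ => mix_pos hw hw1 (S θ)
  have hC := rate_nonneg (ι := ι) hA
  let D : ℝ → (ι → ℝ) → ℝ := fun θ y => (1 + log (mix w (S θ) y))
    * ∑ σ, w σ * ((∑ k, S' θ σ k * (y k - S θ σ k)) * tilt (S θ σ) y)
  let K := Fintype.card ι * (A * (1 + A))
  have hderiv : ∀ θ y, HasDerivAt (fun θ => mix w (S θ) y * log (mix w (S θ) y)) (D θ y) θ := by
    intro θ y
    have h1 : HasDerivAt (fun θ => mix w (S θ) y)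
        (∑ σ, w σ * ((∑ k, S' θ σ k * (y k - S θ σ k)) * tilt (S θ σ) y)) θ :=
      HasDerivAt.fun_sum fun σ _ =>
        (hasDerivAt_tilt_center (fun k => hd θ σ k) y).const_mul (w σ)
    refine (h1.mul (h1.log (hpos θ y).ne')).congr_deriv ?_
    have := (hpos θ y).ne'
    simp only [D]
    field_simp
    ring
  have hbound : ∀ θ y, ‖D θ y‖ ≤ ((1 + rate ι A) * K) * wt y ^ 3 * exp (rate ι A * wt y) := by
    intro θ y
    have h1 := one_le_wt y
    have h3 : wt y ^ 2 ≤ wt y ^ 3 := pow_le_pow_right₀ h1 (by norm_num)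
    have hin : ∀ σ, |∑ k, S' θ σ k * (y k - S θ σ k)| ≤ K * wt y := by
      intro σ
      refine (Finset.abs_sum_le_sum_abs _ _).trans ?_
      refine (Finset.sum_le_card_nsmul _ _ (A * (1 + A) * wt y) fun k _ => ?_).trans ?_
      · rw [abs_mul, mul_assoc]
        refine mul_le_mul (hS' θ σ k) ?_ (abs_nonneg _) hA
        have := abs_sub (y k) (S θ σ k)
        have := abs_le_wt y k
        have := hS θ σ k
        nlinarith
      · simp [K, mul_assoc]
    have hs : |∑ σ, w σ * ((∑ k, S' θ σ k * (y k - S θ σ k)) * tilt (S θ σ) y)|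
        ≤ K * wt y * exp (rate ι A * wt y) := by
      refine (Finset.abs_sum_le_sum_abs _ _).trans ?_
      rw [← one_mul (K * wt y * _), ← hw1, Finset.sum_mul]
      refine Finset.sum_le_sum fun σ _ => ?_
      rw [abs_mul, abs_mul, abs_of_nonneg (hw σ), abs_of_pos (tilt_pos _ _)]
      refine mul_le_mul_of_nonneg_left ?_ (hw σ)
      exact mul_le_mul (hin σ) (tilt_le hA (hS θ σ) y) (tilt_pos _ _).le (by positivity)
    calc ‖D θ y‖ ≤ ((1 + rate ι A) * wt y) * (K * wt y * exp (rate ι A * wt y)) := by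
          rw [Real.norm_eq_abs, abs_mul]
          exact mul_le_mul (abs_one_add_log_mix_le hw hw1 hA (hS θ) y) hs (abs_nonneg _)
            (by positivity)
      _ = ((1 + rate ι A) * K) * wt y ^ 2 * exp (rate ι A * wt y) := by ring
      _ ≤ _ := by gcongr
  have hDc : Continuous (D θ) :=
    (continuous_const.add (continuous_log_mix hw hw1 (S θ))).mul (by fun_prop)
  have main := (hasDerivAt_integral_of_dominated_loc_of_deriv_le (μ := stdGauss ι)
    (F := fun θ y => mix w (S θ) y * log (mix w (S θ) y)) (F' := D) (x₀ := θ) (s := Set.univ)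
    Filter.univ_mem
    (Eventually.of_forall fun θ => (integrable_mix_mul_log hw hw1 hA (hS θ)).1)
    (integrable_mix_mul_log hw hw1 hA (hS θ)) hDc.aestronglyMeasurable
    (ae_of_all _ fun y θ _ => hbound θ y)
    (integrable_of_le_exp (by fun_prop) fun y => by
      have := one_le_wt y
      exact (abs_of_nonneg (by positivity)).le)
    (ae_of_all _ fun y θ _ => hderiv θ y)).2
  refine main.congr_deriv ?_
  have ibp := fun σ k => integral_sub_mul_log_mix hw hw1 hA (hS θ) (hS θ σ) k
  have e1 : D θ = fun y => ∑ σ, ∑ k, w σ * S' θ σ k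
      * ((y k - S θ σ k) * ((1 + log (mix w (S θ) y)) * tilt (S θ σ) y)) := by
    ext y
    simp only [D, Finset.mul_sum, Finset.sum_mul]
    refine Finset.sum_congr rfl fun σ _ => Finset.sum_congr rfl fun k _ => ?_
    ring
  have e2 : (fun y => ∑ k, (∑ σ, w σ * S' θ σ k * tilt (S θ σ) y)
        * (∑ σ, w σ * S θ σ k * tilt (S θ σ) y) / mix w (S θ) y)
      = fun y => ∑ σ, ∑ k, w σ * S' θ σ k
        * (tilt (S θ σ) y * ((∑ τ, w τ * S θ τ k * tilt (S θ τ) y) / mix w (S θ) y)) := by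
    ext y
    rw [Finset.sum_comm]
    refine Finset.sum_congr rfl fun k _ => ?_
    rw [mul_div_assoc, Finset.sum_mul]
    refine Finset.sum_congr rfl fun σ _ => ?_
    ring
  rw [e1, e2, integral_finsetSum _ fun σ _ => integrable_finsetSum _ fun k _ =>
      (ibp σ k).1.const_mul _, integral_finsetSum _ fun σ _ => integrable_finsetSum _ fun k _ =>
      (ibp σ k).2.1.const_mul _]
  refine Finset.sum_congr rfl fun σ _ => ?_
  rw [integral_finsetSum _ fun k _ => (ibp σ k).1.const_mul _,
    integral_finsetSum _ fun k _ => (ibp σ k).2.1.const_mul _]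
  refine Finset.sum_congr rfl fun k _ => ?_
  rw [integral_const_mul, integral_const_mul, (ibp σ k).2.2]

end Mixture

section CameronMartin

variable {ι : Type*} [Fintype ι]

lemma gaussianReal_map_add_eq_withDensity (a : ℝ) :
    (gaussianReal 0 1).map (· + a)
      = (gaussianReal 0 1).withDensity fun t => ENNReal.ofReal (exp (a * t - a ^ 2 / 2)) := by
  rw [gaussianReal_map_add_const, zero_add, gaussianReal_of_var_ne_zero _ one_ne_zero,
    gaussianReal_of_var_ne_zero _ one_ne_zero, ← withDensity_mul _ (by fun_prop) (by fun_prop)]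
  congr 1
  ext t
  simp only [Pi.mul_apply, gaussianPDF]
  rw [← ENNReal.ofReal_mul (gaussianPDFReal_nonneg _ _ _)]
  congr 1
  simp only [gaussianPDFReal]
  rw [mul_assoc (√(2 * π * _))⁻¹, ← exp_add]
  congr 2
  simp
  ring

/-- **Cameron–Martin formula** for the standard Gaussian measure on `ι → ℝ`. -/
lemma stdGauss_map_add (u : ι → ℝ) :
    (stdGauss ι).map (· + u) = (stdGauss ι).withDensity fun y => ENNReal.ofReal (tilt u y) := by
  have h1 : (stdGauss ι).map (· + u)
      = Measure.pi fun k => (gaussianReal 0 1).map (· + u k) := by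
    have : ∀ k, IsProbabilityMeasure ((gaussianReal 0 1).map (· + u k)) := fun k =>
      Measure.isProbabilityMeasure_map (by fun_prop)
    exact Measure.pi_map_pi (f := fun k t => t + u k) fun k => by fun_prop
  have hi : ∀ a : ℝ, Integrable (fun t => exp (a * t - a ^ 2 / 2)) (gaussianReal 0 1) := fun a => by
    simpa [sub_eq_add_neg, exp_add] using
      (integrable_exp_mul_gaussianReal a).mul_const (exp (-(a ^ 2 / 2)))
  have hprob : ∀ k, IsProbabilityMeasure ((gaussianReal 0 1).map (· + u k)) := fun k =>
    Measure.isProbabilityMeasure_map (by fun_prop)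
  rw [h1]
  refine (Measure.pi_eq fun s hs => ?_)
  rw [withDensity_apply _ (MeasurableSet.univ_pi hs), stdGauss, Measure.restrict_pi_pi]
  have e : ∀ y : ι → ℝ, tilt u y = ∏ k, exp (u k * y k - u k ^ 2 / 2) := fun y => exp_sum _ _
  simp only [e]
  rw [← ofReal_integral_eq_lintegral_ofReal
      (Integrable.fintype_prod (f := fun k t => exp (u k * t - u k ^ 2 / 2))
        fun k => (hi _).mono_measure Measure.restrict_le_self)
      (ae_of_all _ fun y => Finset.prod_nonneg fun k _ => (exp_pos _).le),
    integral_fintype_prod_eq_prod (fun k t => exp (u k * t - u k ^ 2 / 2)),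
    ENNReal.ofReal_prod_of_nonneg fun k _ => integral_nonneg fun t => (exp_pos _).le]
  refine Finset.prod_congr rfl fun k _ => ?_
  rw [gaussianReal_map_add_eq_withDensity, withDensity_apply _ (hs k),
    ofReal_integral_eq_lintegral_ofReal ((hi _).mono_measure Measure.restrict_le_self)
      (ae_of_all _ fun y => (exp_pos _).le)]

lemma integral_tilt_mul (u : ι → ℝ) {f : (ι → ℝ) → ℝ} (hf : Measurable f) :
    ∫ y, tilt u y * f y ∂(stdGauss ι) = ∫ y, f (y + u) ∂(stdGauss ι) := by
  rw [← integral_map (φ := (· + u)) (by fun_prop) hf.aestronglyMeasurable, stdGauss_map_add,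
    integral_withDensity_eq_integral_toReal_smul (by fun_prop)
      (ae_of_all _ fun _ => ENNReal.ofReal_lt_top)]
  simp [ENNReal.toReal_ofReal (tilt_pos _ _).le]

lemma integral_tilt (u : ι → ℝ) : ∫ y, tilt u y ∂(stdGauss ι) = 1 := by
  simpa using integral_tilt_mul u (f := fun _ => (1 : ℝ)) measurable_const

lemma integrable_coord_mul_tilt (u : ι → ℝ) (k : ι) :
    Integrable (fun y => y k * tilt u y) (stdGauss ι) := by
  have hu : ∀ k, |u k| ≤ ∑ j, |u j| := fun k =>
    Finset.single_le_sum (f := fun k => |u k|) (fun i _ => abs_nonneg _) (Finset.mem_univ k)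
  have h0 : 0 ≤ ∑ j, |u j| := Finset.sum_nonneg fun _ _ => abs_nonneg _
  refine integrable_of_le_exp (K := 1) (C := rate ι (∑ j, |u j|)) (by fun_prop) fun y => ?_
  have h1 := one_le_wt y
  rw [abs_mul, abs_of_pos (tilt_pos _ _), one_mul]
  exact mul_le_mul ((abs_le_wt y k).trans (le_self_pow₀ h1 (by norm_num))) (tilt_le h0 hu y)
    (tilt_pos _ _).le (by positivity)

/-- Relative entropy of a translated standard Gaussian. -/
lemma integral_tilt_mul_log_tilt (u : ι → ℝ) :
    Integrable (fun y => tilt u y * log (tilt u y)) (stdGauss ι) ∧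
    ∫ y, tilt u y * log (tilt u y) ∂(stdGauss ι) = (∑ k, u k ^ 2) / 2 := by
  classical
  have e : (fun y => tilt u y * log (tilt u y))
      = fun y => ∑ k, (u k * (y k * tilt u y) - u k ^ 2 / 2 * tilt u y) := by
    ext y
    rw [tilt, log_exp, Finset.mul_sum]
    exact Finset.sum_congr rfl fun k _ => by ring
  have i1 := fun k => (integrable_coord_mul_tilt u k).const_mul (u k)
  have i2 := fun k : ι => (integrable_tilt u).const_mul (u k ^ 2 / 2)
  have i3 : ∀ k, Integrable (fun y => u k * (y k * tilt u y) - u k ^ 2 / 2 * tilt u y)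
      (stdGauss ι) := fun k => (i1 k).sub (i2 k)
  rw [e]
  refine ⟨integrable_finsetSum _ fun k _ => i3 k, ?_⟩
  rw [integral_finsetSum _ fun k _ => i3 k, Finset.sum_div]
  refine Finset.sum_congr rfl fun k _ => ?_
  rw [integral_sub (i1 k) (i2 k), integral_const_mul, integral_const_mul,
    stein_pi k (hasDerivAt_tilt_update u · k) (integrable_tilt u) (integrable_coord_mul_tilt u k)
      ((integrable_tilt u).const_mul _), integral_const_mul, integral_tilt]
  ring

/-- The entropy of a mixture as an average over the shifted Gaussians. -/
lemma integral_mix_mul_log_eq_sum {Ω : Type*} [Fintype Ω] {w : Ω → ℝ} (hw : ∀ σ, 0 ≤ w σ)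
    (hw1 : ∑ σ, w σ = 1) (S : Ω → ι → ℝ) :
    ∫ y, mix w S y * log (mix w S y) ∂(stdGauss ι)
      = ∑ σ, w σ * ∫ y, log (mix w S (y + S σ)) ∂(stdGauss ι) := by
  obtain ⟨A, hA, hS⟩ := exists_abs_le S
  have hc := continuous_log_mix hw hw1 S
  simp only [← integral_tilt_mul (S _) hc.measurable, ← integral_const_mul]
  rw [← integral_finsetSum _ fun σ _ =>
    (integrable_tilt_mul_log_mix hw hw1 hA hS (hS σ)).const_mul _]
  congr 1
  ext y
  rw [mix, Finset.sum_mul]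
  exact Finset.sum_congr rfl fun σ _ => mul_assoc _ _ _

end CameronMartin

section MutualInformation

variable {ι : Type*} [Fintype ι] {Ω : Type*} [Fintype Ω] [MeasurableSpace Ω]
  [MeasurableSingletonClass Ω]

/-- Mutual information is invariant under measurable embeddings of both coordinates. -/
lemma mutualInfoR_map {α β α' β' : Type*} [MeasurableSpace α] [MeasurableSpace β]
    [MeasurableSpace α'] [MeasurableSpace β'] {μ : Measure (α × β)} [IsProbabilityMeasure μ]
    (hμ : μ ≪ μ.fst.prod μ.snd) {f : α → α'} {g : β → β'} (hf : MeasurableEmbedding f)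
    (hg : MeasurableEmbedding g) :
    mutualInfoR (μ.map (Prod.map f g)) = mutualInfoR μ := by
  have hfg : MeasurableEmbedding (Prod.map f g) := hf.prodMap hg
  have h1 : (μ.map (Prod.map f g)).fst = μ.fst.map f := by
    rw [Measure.fst, Measure.fst, Measure.map_map measurable_fst hfg.measurable,
      Measure.map_map hf.measurable measurable_fst]
    rfl
  have h2 : (μ.map (Prod.map f g)).snd = μ.snd.map g := by
    rw [Measure.snd, Measure.snd, Measure.map_map measurable_snd hfg.measurable,
      Measure.map_map hg.measurable measurable_snd]
    rfl
  unfold mutualInfoR klDivR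
  rw [h1, h2, Measure.map_prod_map _ _ hf.measurable hg.measurable, hfg.integral_map]
  refine integral_congr_ae ?_
  filter_upwards [hμ.ae_le (hfg.rnDeriv_map μ (μ.fst.prod μ.snd))] with a ha
  simp only [llr, ha]

/-- Joint law of a discrete signal `σ` and of its observation `u σ + z` in Gaussian noise `z`. -/
def jointLaw (μ : Measure Ω) (u : Ω → ι → ℝ) : Measure (Ω × (ι → ℝ)) :=
  (μ.prod (stdGauss ι)).map fun w => (w.1, w.2 + u w.1)

lemma measurable_channel {ι : Type*} (u : Ω → ι → ℝ) : Measurable fun w : Ω × (ι → ℝ) => (w.1, w.2 + u w.1) :=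
  measurable_fst.prodMk (measurable_snd.add ((measurable_of_finite u).comp measurable_fst))

variable (μ : Measure Ω) [IsProbabilityMeasure μ] (u : Ω → ι → ℝ)

instance : IsProbabilityMeasure (jointLaw μ u) :=
  Measure.isProbabilityMeasure_map (measurable_channel u).aemeasurable

lemma measurable_tilt_uncurry : Measurable fun w : Ω × (ι → ℝ) => tilt (u w.1) w.2 :=
  measurable_from_prod_countable_right fun σ => (continuous_tilt (u σ)).measurable

lemma jointLaw_eq_withDensity (μ : Measure Ω) (u : Ω → ι → ℝ) :
    jointLaw μ u = (μ.prod (stdGauss ι)).withDensity fun w => ENNReal.ofReal (tilt (u w.1) w.2) := by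
  have hm := (measurable_tilt_uncurry u).ennreal_ofReal
  refine Measure.ext_of_lintegral _ fun φ hφ => ?_
  have hφu : Measurable fun w : Ω × (ι → ℝ) => φ (w.1, w.2 + u w.1) :=
    hφ.comp (measurable_channel u)
  rw [jointLaw, lintegral_map hφ (measurable_channel u),
    lintegral_prod _ hφu.aemeasurable,
    lintegral_withDensity_eq_lintegral_mul _ hm hφ, lintegral_prod _ (hm.mul hφ).aemeasurable]
  refine lintegral_congr fun σ => ?_
  have hφσ : Measurable fun y => φ (σ, y) := hφ.comp measurable_prodMk_left
  rw [← lintegral_map (f := fun y => φ (σ, y)) (g := (· + u σ)) hφσ (by fun_prop),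
    stdGauss_map_add, lintegral_withDensity_eq_lintegral_mul _ (by fun_prop) hφσ]
  rfl

lemma jointLaw_fst (μ : Measure Ω) (u : Ω → ι → ℝ) : (jointLaw μ u).fst = μ := by
  rw [jointLaw, Measure.fst, Measure.map_map measurable_fst (measurable_channel u)]
  exact (Measure.fst_prod (μ := μ) (ν := stdGauss ι))

lemma jointLaw_snd : (jointLaw μ u).snd
    = (stdGauss ι).withDensity fun y => ENNReal.ofReal (mix (fun σ => μ.real {σ}) u y) := by
  have hm := (measurable_tilt_uncurry u).ennreal_ofReal
  refine Measure.ext_of_lintegral _ fun φ hφ => ?_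
  have hφ2 : Measurable fun w : Ω × (ι → ℝ) => φ w.2 := hφ.comp measurable_snd
  rw [Measure.snd, lintegral_map hφ measurable_snd, jointLaw_eq_withDensity,
    lintegral_withDensity_eq_lintegral_mul _ hm hφ2,
    lintegral_prod_symm _ (hm.mul hφ2).aemeasurable,
    lintegral_withDensity_eq_lintegral_mul _ (by fun_prop) hφ]
  refine lintegral_congr fun y => ?_
  simp only [Pi.mul_apply]
  rw [lintegral_mul_const _ (measurable_of_finite _), lintegral_fintype, mix,
    ENNReal.ofReal_sum_of_nonneg fun σ _ => mul_nonneg measureReal_nonneg (tilt_pos _ _).le]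
  congr 1
  refine Finset.sum_congr rfl fun σ _ => ?_
  rw [ENNReal.ofReal_mul measureReal_nonneg, ofReal_measureReal, mul_comm]

lemma sum_measureReal_singleton : ∑ σ, μ.real {σ} = 1 := by
  simp

/-- Mutual information of a Gaussian channel with discrete input. -/
lemma mutualInfoR_jointLaw :
    jointLaw μ u ≪ (jointLaw μ u).fst.prod (jointLaw μ u).snd ∧
    0 ≤ mutualInfoR (jointLaw μ u) ∧
    mutualInfoR (jointLaw μ u) = ∑ σ, μ.real {σ} * ((∑ k, u σ k ^ 2) / 2)
      - ∫ y, mix (fun σ => μ.real {σ}) u y * log (mix (fun σ => μ.real {σ}) u y)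
        ∂(stdGauss ι) := by
  have hw : ∀ σ, 0 ≤ μ.real {σ} := fun σ => measureReal_nonneg
  have hw1 := sum_measureReal_singleton μ
  set W := mix (fun σ => μ.real {σ}) u with hW
  have hpos : ∀ y, 0 < W y := mix_pos hw hw1 u
  have hWc : Continuous W := continuous_mix _ _
  obtain ⟨A, hA, hu⟩ := exists_abs_le u
  have ht := measurable_tilt_uncurry u
  have hWm : Measurable fun w : Ω × (ι → ℝ) => W w.2 := hWc.measurable.comp measurable_snd
  have hq : Measurable fun w : Ω × (ι → ℝ) => tilt (u w.1) w.2 / W w.2 := ht.div hWm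
  have hN : (jointLaw μ u).fst.prod (jointLaw μ u).snd
      = (μ.prod (stdGauss ι)).withDensity fun w => ENNReal.ofReal (W w.2) := by
    rw [jointLaw_fst, jointLaw_snd, prod_withDensity_right (by fun_prop)]
  have hJ : jointLaw μ u = ((jointLaw μ u).fst.prod (jointLaw μ u).snd).withDensity
      fun w => ENNReal.ofReal (tilt (u w.1) w.2 / W w.2) := by
    rw [hN, ← withDensity_mul _ hWm.ennreal_ofReal hq.ennreal_ofReal,
      jointLaw_eq_withDensity]
    congr 1
    ext w
    rw [Pi.mul_apply, ← ENNReal.ofReal_mul (hpos _).le, mul_div_cancel₀ _ (hpos _).ne']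
  set N := (jointLaw μ u).fst.prod (jointLaw μ u).snd with hNdef
  have hac : jointLaw μ u ≪ N := by rw [hJ]; exact withDensity_absolutelyContinuous _ _
  have hllr : llr (jointLaw μ u) N =ᵐ[jointLaw μ u]
      fun w => log (tilt (u w.1) w.2 / W w.2) := by
    have h := Measure.rnDeriv_withDensity N hq.ennreal_ofReal
    rw [← hJ] at h
    filter_upwards [hac.ae_le h] with w hw'
    rw [llr, hw', ENNReal.toReal_ofReal (div_pos (tilt_pos _ _) (hpos _)).le]
  have hσ : ∀ σ, Integrable (fun y => tilt (u σ) y * log (W y)) (stdGauss ι) := fun σ =>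
    integrable_tilt_mul_log_mix hw hw1 hA hu (hu σ)
  have hlog : ∀ σ y, tilt (u σ) y * log (tilt (u σ) y / W y)
      = tilt (u σ) y * log (tilt (u σ) y) - tilt (u σ) y * log (W y) := fun σ y => by
    rw [log_div (tilt_pos _ _).ne' (hpos y).ne', mul_sub]
  have hm : Measurable fun w : Ω × (ι → ℝ) => tilt (u w.1) w.2 * log (tilt (u w.1) w.2 / W w.2) :=
    ht.mul hq.log
  have hint : Integrable (fun w : Ω × (ι → ℝ) => tilt (u w.1) w.2 * log (tilt (u w.1) w.2 / W w.2))
      (μ.prod (stdGauss ι)) := by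
    rw [integrable_prod_iff hm.aestronglyMeasurable]
    refine ⟨ae_of_all _ fun σ => ?_, Integrable.of_finite⟩
    simp only [hlog]
    exact (integral_tilt_mul_log_tilt (u σ)).1.sub (hσ σ)
  have hval : mutualInfoR (jointLaw μ u) = ∑ σ, μ.real {σ} * ((∑ k, u σ k ^ 2) / 2)
      - ∫ y, W y * log (W y) ∂(stdGauss ι) := by
    rw [mutualInfoR, klDivR, integral_congr_ae hllr, jointLaw_eq_withDensity,
      integral_withDensity_eq_integral_toReal_smul ht.ennreal_ofReal
        (ae_of_all _ fun _ => ENNReal.ofReal_lt_top)]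
    simp only [ENNReal.toReal_ofReal (tilt_pos _ _).le, smul_eq_mul]
    rw [integral_prod _ hint, integral_fintype Integrable.of_finite]
    simp only [hlog, smul_eq_mul]
    simp only [integral_sub (integral_tilt_mul_log_tilt _).1 (hσ _),
      (integral_tilt_mul_log_tilt _).2, mul_sub, Finset.sum_sub_distrib]
    congr 1
    simp only [← integral_const_mul]
    rw [← integral_finsetSum _ fun σ _ => (hσ σ).const_mul _]
    congr 1
    ext y
    simp only [hW, mix, Finset.sum_mul, mul_assoc]
  refine ⟨hac, ?_, hval⟩
  have hli : Integrable (llr (jointLaw μ u) N) (jointLaw μ u) := by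
    refine Integrable.congr ?_ hllr.symm
    rw [jointLaw_eq_withDensity, integrable_withDensity_iff_integrable_smul' ht.ennreal_ofReal
      (ae_of_all _ fun _ => ENNReal.ofReal_lt_top)]
    simpa only [ENNReal.toReal_ofReal (tilt_pos _ _).le, smul_eq_mul] using hint
  have hNprob : IsProbabilityMeasure N := by rw [hNdef]; infer_instance
  have h := InformationTheory.integral_llr_add_sub_measure_univ_nonneg hac hli
  simp only [probReal_univ] at h
  rw [mutualInfoR, klDivR, ← hNdef]
  linarith

end MutualInformation

section Interpolation

lemma sum_symIdx_mul {n : ℕ} (a : Fin n → ℝ) :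
    ∑ q : SymIdx n, a q.1.1 * a q.1.2 = ((∑ i, a i) ^ 2 + ∑ i, a i ^ 2) / 2 := by
  have h1 : ∑ q : SymIdx n, a q.1.1 * a q.1.2
      = ∑ i, ∑ j, if i ≤ j then a i * a j else 0 := by
    rw [← Fintype.sum_prod_type' (f := fun i j => if i ≤ j then a i * a j else 0),
      ← Finset.sum_filter]
    refine (Finset.sum_subtype (p := fun q : Fin n × Fin n => q.1 ≤ q.2) _ (fun q => ?_)
      fun q => a q.1 * a q.2).symm
    simp
  have h2 : ∑ i, ∑ j, (if i ≤ j then a i * a j else 0)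
      = ∑ i, ∑ j, if j ≤ i then a i * a j else 0 := by
    rw [Finset.sum_comm]
    exact Finset.sum_congr rfl fun i _ => Finset.sum_congr rfl fun j _ => by rw [mul_comm]
  have h3 : (∑ i, a i) ^ 2 + ∑ i, a i ^ 2 = ∑ i, ∑ j, (if i ≤ j then a i * a j else 0)
      + ∑ i, ∑ j, if j ≤ i then a i * a j else 0 := by
    rw [sq, Finset.sum_mul_sum, ← Finset.sum_add_distrib, ← Finset.sum_add_distrib]
    refine Finset.sum_congr rfl fun i _ => ?_
    have : a i ^ 2 = ∑ j, if i = j then a i * a j else 0 := by simp [sq]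
    rw [this, ← Finset.sum_add_distrib, ← Finset.sum_add_distrib]
    refine Finset.sum_congr rfl fun j _ => ?_
    rcases lt_trichotomy i j with h | h | h
    · simp [h.le, h.ne, h.not_ge]
    · simp [h]
    · simp [h.le, h.ne', h.not_ge]
  rw [h1, h3, ← h2]
  ring

/-- Comparison of quadratic and linear overlaps between two replicas. -/
lemma replica_bound {Ω : Type*} [Fintype Ω] {n : ℕ} {v : Ω → ℝ} (hv : ∀ σ, 0 ≤ v σ)
    (X : Ω → Fin n → ℝ) (c : ℝ) :
    -(c ^ 2 / 2) * (∑ σ, v σ) ^ 2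
      ≤ ∑ q : SymIdx n, (∑ σ, v σ * (X σ q.1.1 * X σ q.1.2)) ^ 2
        - c * ∑ i, (∑ σ, v σ * X σ i) ^ 2 := by
  have expand : ∀ f : Ω → ℝ, (∑ σ, v σ * f σ) ^ 2
      = ∑ σ, ∑ τ, v σ * v τ * (f σ * f τ) := fun f => by
    rw [sq, Finset.sum_mul_sum]
    exact Finset.sum_congr rfl fun σ _ => Finset.sum_congr rfl fun τ _ => by ring
  have h1 : (∑ σ, v σ) ^ 2 = ∑ σ, ∑ τ, v σ * v τ := by rw [sq, Finset.sum_mul_sum]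
  have h2 : ∑ q : SymIdx n, (∑ σ, v σ * (X σ q.1.1 * X σ q.1.2)) ^ 2
      = ∑ σ, ∑ τ, v σ * v τ
        * (((∑ i, X σ i * X τ i) ^ 2 + ∑ i, (X σ i * X τ i) ^ 2) / 2) := by
    simp only [← sum_symIdx_mul, expand, Finset.mul_sum]
    rw [Finset.sum_comm]
    refine Finset.sum_congr rfl fun σ _ => ?_
    rw [Finset.sum_comm]
    exact Finset.sum_congr rfl fun τ _ => Finset.sum_congr rfl fun q _ => by ring
  have h3 : ∑ i, (∑ σ, v σ * X σ i) ^ 2 = ∑ σ, ∑ τ, v σ * v τ * ∑ i, X σ i * X τ i := by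
    simp only [expand, Finset.mul_sum]
    rw [Finset.sum_comm]
    exact Finset.sum_congr rfl fun σ _ => Finset.sum_comm
  rw [h1, h2, h3]
  simp only [Finset.mul_sum, ← Finset.sum_sub_distrib]
  refine Finset.sum_le_sum fun σ _ => Finset.sum_le_sum fun τ _ => ?_
  simp only [← Finset.mul_sum]
  have h4 : 0 ≤ ∑ i, (X σ i * X τ i) ^ 2 := Finset.sum_nonneg fun _ _ => sq_nonneg _
  nlinarith [mul_nonneg (mul_nonneg (hv σ) (hv τ)) h4,
    mul_nonneg (mul_nonneg (hv σ) (hv τ)) (sq_nonneg (∑ i, X σ i * X τ i - c))]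

lemma stdGauss_map_sum {κ ι : Type*} [Fintype κ] [Fintype ι] :
    (stdGauss (κ ⊕ ι)).map (fun y => (fun k => y (Sum.inl k), fun i => y (Sum.inr i)))
      = (stdGauss κ).prod (stdGauss ι) :=
  (measurePreserving_sumPiEquivProdPi fun _ : κ ⊕ ι => gaussianReal 0 1).map_eq

variable {Ω : Type*} [Fintype Ω]

lemma integral_mix_sum_inl {κ ι : Type*} [Fintype κ] [Fintype ι] (w : Ω → ℝ) (S : Ω → κ → ℝ)
    {φ : ℝ → ℝ} (hφ : Measurable φ) :
    ∫ y, φ (mix w (fun σ => Sum.elim (S σ) fun _ : ι => 0) y) ∂(stdGauss (κ ⊕ ι))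
      = ∫ y, φ (mix w S y) ∂(stdGauss κ) := by
  have h := integral_map (μ := stdGauss (κ ⊕ ι))
    (φ := fun y => ((fun k => y (Sum.inl k) : κ → ℝ), (fun i => y (Sum.inr i) : ι → ℝ)))
    (by fun_prop) (f := fun w' => φ (mix w S w'.1))
    (hφ.comp ((continuous_mix w S).measurable.comp measurable_fst)).aestronglyMeasurable
  rw [stdGauss_map_sum, integral_fun_fst (f := fun y => φ (mix w S y))] at h
  simpa [mix, tilt] using h.symm

lemma integral_mix_sum_inr {κ ι : Type*} [Fintype κ] [Fintype ι] (w : Ω → ℝ) (S : Ω → ι → ℝ)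
    {φ : ℝ → ℝ} (hφ : Measurable φ) :
    ∫ y, φ (mix w (fun σ => Sum.elim (fun _ : κ => 0) (S σ)) y) ∂(stdGauss (κ ⊕ ι))
      = ∫ y, φ (mix w S y) ∂(stdGauss ι) := by
  have h := integral_map (μ := stdGauss (κ ⊕ ι))
    (φ := fun y => ((fun k => y (Sum.inl k) : κ → ℝ), (fun i => y (Sum.inr i) : ι → ℝ)))
    (by fun_prop) (f := fun w' => φ (mix w S w'.2))
    (hφ.comp ((continuous_mix w S).measurable.comp measurable_snd)).aestronglyMeasurable
  rw [stdGauss_map_sum, integral_fun_snd (f := fun y => φ (mix w S y))] at h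
  simpa [mix, tilt] using h.symm

/-- Interpolation between the quadratic channel and the decoupled linear channel. -/
lemma interpolation_bound {w : Ω → ℝ} (hw : ∀ σ, 0 ≤ w σ) (hw1 : ∑ σ, w σ = 1) {n : ℕ}
    (X : Ω → Fin n → ℝ) {a b c : ℝ} (hc : b ^ 2 = c * a ^ 2) :
    ∫ y, mix w (fun σ i => b * X σ i) y * log (mix w (fun σ i => b * X σ i) y)
        ∂(stdGauss (Fin n)) - a ^ 2 * c ^ 2 / 4
      ≤ ∫ y, mix w (fun σ (q : SymIdx n) => a * (X σ q.1.1 * X σ q.1.2)) y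
          * log (mix w (fun σ (q : SymIdx n) => a * (X σ q.1.1 * X σ q.1.2)) y)
        ∂(stdGauss (SymIdx n)) := by
  let U : Ω → SymIdx n → ℝ := fun σ q => a * (X σ q.1.1 * X σ q.1.2)
  let V : Ω → Fin n → ℝ := fun σ i => b * X σ i
  let S : ℝ → Ω → SymIdx n ⊕ Fin n → ℝ := fun θ σ =>
    Sum.elim (fun q => sin θ * U σ q) fun i => cos θ * V σ i
  let S' : ℝ → Ω → SymIdx n ⊕ Fin n → ℝ := fun θ σ =>
    Sum.elim (fun q => cos θ * U σ q) fun i => -sin θ * V σ i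
  obtain ⟨A, hA, hUV⟩ := exists_abs_le fun σ => Sum.elim (U σ) (V σ)
  have hmul : ∀ {s x : ℝ}, |s| ≤ 1 → |x| ≤ A → |s * x| ≤ A := fun {s x} hs hx => by
    rw [abs_mul]
    exact (mul_le_of_le_one_left (abs_nonneg x) hs).trans hx
  have hS : ∀ θ σ k, |S θ σ k| ≤ A := by
    rintro θ σ (q | i)
    · exact hmul (abs_sin_le_one θ) (hUV σ (Sum.inl q))
    · exact hmul (abs_cos_le_one θ) (hUV σ (Sum.inr i))
  have hS' : ∀ θ σ k, |S' θ σ k| ≤ A := by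
    rintro θ σ (q | i)
    · exact hmul (abs_cos_le_one θ) (hUV σ (Sum.inl q))
    · exact hmul (by simpa using abs_sin_le_one θ) (hUV σ (Sum.inr i))
  have hd : ∀ θ σ k, HasDerivAt (fun θ => S θ σ k) (S' θ σ k) θ := by
    rintro θ σ (q | i)
    · exact (hasDerivAt_sin θ).mul_const _
    · exact (hasDerivAt_cos θ).mul_const _
  let Φ : ℝ → ℝ := fun θ => ∫ y, mix w (S θ) y * log (mix w (S θ) y) ∂(stdGauss _)
  have hΦ := hasDerivAt_integral_mix_mul_log hw hw1 hA hS hS' hd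
  have hpos := fun θ => mix_pos hw hw1 (S θ)
  have hmix1 : ∀ θ, ∫ y, mix w (S θ) y ∂(stdGauss _) = 1 := fun θ => by
    simp only [mix]
    rw [integral_finsetSum _ fun σ _ => (integrable_tilt _).const_mul _]
    simp only [integral_const_mul, integral_tilt, mul_one, hw1]
  have hmixi : ∀ θ, Integrable (mix w (S θ)) (stdGauss _) := fun θ =>
    integrable_finsetSum _ fun σ _ => (integrable_tilt _).const_mul _
  have hint : ∀ θ k, Integrable (fun y => (∑ σ, w σ * S' θ σ k * tilt (S θ σ) y)
      * (∑ σ, w σ * S θ σ k * tilt (S θ σ) y) / mix w (S θ) y) (stdGauss _) := fun θ k => by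
    refine ((hmixi θ).const_mul (A * A)).mono' (Continuous.aestronglyMeasurable
      (Continuous.div (by fun_prop) (by fun_prop) fun y => (hpos θ y).ne')) (ae_of_all _ fun y => ?_)
    rw [norm_div, norm_mul, Real.norm_eq_abs, Real.norm_eq_abs, Real.norm_eq_abs,
      abs_of_pos (hpos θ y), div_le_iff₀ (hpos θ y)]
    calc _ ≤ (A * mix w (S θ) y) * (A * mix w (S θ) y) :=
          mul_le_mul (abs_sum_mul_tilt_le hw (hS' θ · k) _ y)
            (abs_sum_mul_tilt_le hw (hS θ · k) _ y) (abs_nonneg _)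
            (mul_nonneg hA (hpos θ y).le)
      _ = _ := by ring
  have hlow : ∀ θ y, sin θ * cos θ * (∑ q : SymIdx n, (∑ σ, w σ * tilt (S θ σ) y
        * (X σ q.1.1 * X σ q.1.2)) ^ 2 - c * ∑ i, (∑ σ, w σ * tilt (S θ σ) y * X σ i) ^ 2)
          * a ^ 2 / mix w (S θ) y
      = ∑ k, (∑ σ, w σ * S' θ σ k * tilt (S θ σ) y) * (∑ σ, w σ * S θ σ k * tilt (S θ σ) y)
        / mix w (S θ) y := fun θ y => by
    rw [← Finset.sum_div, Fintype.sum_sum_type]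
    congr 1
    have pull : ∀ {f g : Ω → ℝ} {s : ℝ}, (∀ σ, g σ = s * f σ) →
        ∑ σ, w σ * g σ * tilt (S θ σ) y = s * ∑ σ, w σ * tilt (S θ σ) y * f σ := by
      intro f g s h
      rw [Finset.mul_sum]
      exact Finset.sum_congr rfl fun σ _ => by rw [h]; ring
    rw [mul_sub, sub_mul, sub_eq_add_neg]
    congr 1
    · rw [Finset.mul_sum, Finset.sum_mul]
      refine Finset.sum_congr rfl fun q _ => ?_
      rw [pull (f := fun σ => X σ q.1.1 * X σ q.1.2) (s := cos θ * a) fun σ => by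
          simp only [S', U, Sum.elim_inl]; ring,
        pull (f := fun σ => X σ q.1.1 * X σ q.1.2) (s := sin θ * a) fun σ => by
          simp only [S, U, Sum.elim_inl]; ring]
      ring
    · rw [Finset.mul_sum, Finset.mul_sum, Finset.sum_mul, ← Finset.sum_neg_distrib]
      refine Finset.sum_congr rfl fun i _ => ?_
      rw [pull (f := fun σ => X σ i) (s := -sin θ * b) fun σ => by
          simp only [S', V, Sum.elim_inr]; ring,
        pull (f := fun σ => X σ i) (s := cos θ * b) fun σ => by
          simp only [S, V, Sum.elim_inr]; ring]
      linear_combination (sin θ * cos θ * (∑ σ, w σ * tilt (S θ σ) y * X σ i) ^ 2) * hc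
  have hderiv : ∀ θ, 0 ≤ sin θ * cos θ → -(a ^ 2 * c ^ 2 / 2) * (sin θ * cos θ)
      ≤ ∫ y, ∑ k, (∑ σ, w σ * S' θ σ k * tilt (S θ σ) y)
        * (∑ σ, w σ * S θ σ k * tilt (S θ σ) y) / mix w (S θ) y ∂(stdGauss _) := by
    intro θ hθ
    rw [← mul_one (_ * _), ← hmix1 θ, ← integral_const_mul]
    refine integral_mono ((hmixi θ).const_mul _) (integrable_finsetSum _ fun k _ => hint θ k)
      fun y => ?_
    simp only
    rw [← hlow θ y, le_div_iff₀ (hpos θ y)]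
    have h := replica_bound (fun σ => mul_nonneg (hw σ) (tilt_pos (S θ σ) y).le) X c
    have h2 := mul_le_mul_of_nonneg_left h (mul_nonneg hθ (sq_nonneg a))
    rw [← mix] at h2
    linarith
  have hmono : MonotoneOn (fun θ => Φ θ + a ^ 2 * c ^ 2 / 4 * sin θ ^ 2) (Set.Icc 0 (π / 2)) := by
    have hD : ∀ θ, HasDerivAt (fun θ => Φ θ + a ^ 2 * c ^ 2 / 4 * sin θ ^ 2) _ θ := fun θ =>
      (hΦ θ).add (((hasDerivAt_sin θ).pow 2).const_mul (a ^ 2 * c ^ 2 / 4))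
    refine monotoneOn_of_deriv_nonneg (convex_Icc _ _)
      (fun θ _ => (hD θ).continuousAt.continuousWithinAt)
      (fun θ _ => (hD θ).differentiableAt.differentiableWithinAt) fun θ hθ => ?_
    rw [interior_Icc] at hθ
    have h := hderiv θ (mul_nonneg (sin_nonneg_of_nonneg_of_le_pi hθ.1.le (by linarith [hθ.2, pi_pos]))
      (cos_nonneg_of_neg_pi_div_two_le_of_le (by linarith [hθ.1, pi_pos]) hθ.2.le))
    rw [(hD θ).deriv]
    push_cast
    linarith
  have key := hmono (Set.left_mem_Icc.2 (by positivity)) (Set.right_mem_Icc.2 (by positivity))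
    (by positivity : (0 : ℝ) ≤ π / 2)
  have hlogm : Measurable fun t : ℝ => t * log t := by fun_prop
  have e0 : S 0 = fun σ => Sum.elim (fun _ => 0) (V σ) := by
    ext σ (q | i) <;> simp [S]
  have e1 : S (π / 2) = fun σ => Sum.elim (U σ) fun _ => 0 := by
    ext σ (q | i) <;> simp [S]
  have f0 := integral_mix_sum_inr (κ := SymIdx n) w V hlogm
  have f1 := integral_mix_sum_inl (ι := Fin n) w U hlogm
  simp only [Φ, e0, e1, f0, f1, sin_zero, sin_pi_div_two] at key
  linarith

end Interpolation

section DiscreteSignal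

variable {K : Type*} [Fintype K] [MeasurableSpace K] (ν : Measure K) [IsProbabilityMeasure ν]
  {n : ℕ}

lemma mix_pi_eq_prod (x : K → ℝ) (y : Fin n → ℝ) :
    mix (fun σ => (Measure.pi fun _ : Fin n => ν).real {σ}) (fun σ i => x (σ i)) y
      = ∏ i, mix (fun k => ν.real {k}) (fun k (_ : Unit) => x k) fun _ => y i := by
  simp only [mix, tilt, Finset.prod_univ_sum, Fintype.piFinset_univ, Finset.prod_mul_distrib,
    exp_sum, Finset.univ_unique, Finset.sum_singleton, measureReal_def,
    Measure.pi_singleton, ENNReal.toReal_prod]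

variable [MeasurableSingletonClass K]

/-- Log-density of the scalar Gaussian channel with input of law `ν` and signal `x`. -/
def scalarLog (x : K → ℝ) (t : ℝ) : ℝ :=
  log (mix (fun k => ν.real {k}) (fun k (_ : Unit) => x k) fun _ => t)

lemma continuous_scalarLog (x : K → ℝ) : Continuous (scalarLog ν x) :=
  (continuous_log_mix (fun _ => measureReal_nonneg) (sum_measureReal_singleton ν) _).comp
    (continuous_pi fun _ => continuous_id)

lemma integrable_scalarLog_add (x : K → ℝ) (a : ℝ) :
    Integrable (fun t => scalarLog ν x (t + a)) (gaussianReal 0 1) := by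
  obtain ⟨A, hA, hx⟩ := exists_abs_le fun k (_ : Unit) => x k
  have hid : Integrable (fun t : ℝ => t) (gaussianReal 0 1) :=
    (memLp_id_gaussianReal 1).integrable le_rfl
  refine (((integrable_const 1).add (hid.add (integrable_const a)).abs).const_mul (rate Unit A)).mono'
    ((continuous_scalarLog ν x).comp (by fun_prop)).aestronglyMeasurable (ae_of_all _ fun t => ?_)
  simpa [wt, scalarLog] using abs_log_mix_le (fun _ => measureReal_nonneg)
    (sum_measureReal_singleton ν) hA hx fun _ => t + a

/-- The entropy of the decoupled channel is additive over coordinates. -/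
lemma integral_mix_pi_mul_log (x : K → ℝ) :
    ∫ y, mix (fun σ => (Measure.pi fun _ : Fin n => ν).real {σ}) (fun σ i => x (σ i)) y
        * log (mix (fun σ => (Measure.pi fun _ : Fin n => ν).real {σ}) (fun σ i => x (σ i)) y)
        ∂(stdGauss (Fin n))
      = n * ∫ w, scalarLog ν x (w.2 + x w.1) ∂(ν.prod (gaussianReal 0 1)) := by
  have hm : Measurable fun w : K × ℝ => scalarLog ν x (w.2 + x w.1) :=
    measurable_from_prod_countable_right fun k =>
      ((continuous_scalarLog ν x).comp (continuous_add_const (x k))).measurable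
  have hi : Integrable (fun w : K × ℝ => scalarLog ν x (w.2 + x w.1))
      (ν.prod (gaussianReal 0 1)) := by
    rw [integrable_prod_iff hm.aestronglyMeasurable]
    exact ⟨ae_of_all _ fun k => integrable_scalarLog_add ν x (x k), Integrable.of_finite⟩
  rw [integral_mix_mul_log_eq_sum (fun _ => measureReal_nonneg) (sum_measureReal_singleton _),
    integral_prod _ hi]
  have hlog : ∀ (y : Fin n → ℝ) (σ : Fin n → K), log (mix (fun σ => (Measure.pi fun _ : Fin n => ν).real {σ})
      (fun σ i => x (σ i)) (y + fun i => x (σ i))) = ∑ i, scalarLog ν x (y i + x (σ i)) := by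
    intro y σ
    rw [mix_pi_eq_prod, log_prod fun i _ => (mix_pos (fun _ => measureReal_nonneg)
      (sum_measureReal_singleton ν) _ _).ne']
    rfl
  have hc : ∀ a : ℝ, AEStronglyMeasurable (fun t => scalarLog ν x (t + a)) (gaussianReal 0 1) :=
    fun a => (integrable_scalarLog_add ν x a).1
  have hσ : ∀ σ : Fin n → K, ∫ y, ∑ i, scalarLog ν x (y i + x (σ i)) ∂(stdGauss (Fin n))
      = ∑ i, ∫ t, scalarLog ν x (t + x (σ i)) ∂(gaussianReal 0 1) := fun σ => by
    rw [integral_finsetSum _ fun i _ => integrable_comp_eval (μ := fun _ => gaussianReal 0 1)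
      (integrable_scalarLog_add ν x (x (σ i)))]
    exact Finset.sum_congr rfl fun i _ =>
      integral_comp_eval (μ := fun _ => gaussianReal 0 1) (hc (x (σ i)))
  simp only [hlog, hσ]
  have h := integral_fintype (μ := Measure.pi fun _ : Fin n => ν)
    (f := fun σ => ∑ i, ∫ t, scalarLog ν x (t + x (σ i)) ∂(gaussianReal 0 1)) Integrable.of_finite
  simp only [smul_eq_mul] at h
  rw [← h, integral_finsetSum _ fun i _ => Integrable.of_finite]
  simp only [integral_comp_eval (μ := fun _ : Fin n => ν)
    (f := fun k => ∫ t, scalarLog ν x (t + x k) ∂(gaussianReal 0 1))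
    (measurable_of_finite _).aestronglyMeasurable]
  simp

/-- Second moment of the squared norm of a random vector with i.i.d. coordinates. -/
lemma integral_pi_sum_sq (f : K → ℝ) :
    ∫ σ, (∑ i, f (σ i)) ^ 2 ∂(Measure.pi fun _ : Fin n => ν)
      = n * (∫ k, f k ^ 2 ∂ν) + n * (n - 1) * (∫ k, f k ∂ν) ^ 2 := by
  have hf : MemLp f 2 ν := MemLp.of_discrete
  have h := variance_sum_pi (ι := Fin n) (μ := fun _ => ν) (X := fun _ => f) fun _ => hf
  have hs : ∑ i, (fun σ : Fin n → K => f (σ i)) = fun σ => ∑ i, f (σ i) := by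
    ext σ; simp
  rw [hs, variance_eq_sub MemLp.of_discrete, variance_eq_sub hf] at h
  have hE : ∫ σ, ∑ i, f (σ i) ∂(Measure.pi fun _ : Fin n => ν) = n * ∫ k, f k ∂ν := by
    rw [integral_finsetSum _ fun i _ => Integrable.of_finite]
    simp [integral_comp_eval (μ := fun _ : Fin n => ν) hf.1]
  simp only [Pi.pow_apply, hE, Finset.sum_const, Finset.card_univ, Fintype.card_fin,
    nsmul_eq_mul] at h
  linear_combination h

/-- Nonnegativity and the upper bound for a signal taking finitely many values. -/
lemma mutualInfoR_spiked_le (x : K → ℝ) {Δ m : ℝ} (hΔ : 0 < Δ) (hm : 0 ≤ m) (hn : 1 ≤ n) :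
    mutualInfoR (jointLaw (Measure.pi fun _ : Fin n => ν)
        fun σ (q : SymIdx n) => x (σ q.1.1) * x (σ q.1.2) / √n / √Δ) / n
      ≤ (m ^ 2 + (∫ k, x k ^ 2 ∂ν) ^ 2) / (4 * Δ)
        - ∫ w, scalarLog ν (fun k => √(m / Δ) * x k) (w.2 + √(m / Δ) * x w.1)
          ∂(ν.prod (gaussianReal 0 1))
        + (2 * (∫ k, x k ^ 4 ∂ν) - (∫ k, x k ^ 2 ∂ν) ^ 2) / (4 * n * Δ) := by
  have hn0 : (0 : ℝ) < n := by exact_mod_cast hn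
  set μ := Measure.pi fun _ : Fin n => ν with hμ
  have hsn := sq_sqrt hn0.le
  have hsΔ := sq_sqrt hΔ.le
  have hsm := sq_sqrt (div_nonneg hm hΔ.le)
  have hsn0 := sqrt_pos.2 hn0
  have hsΔ0 := sqrt_pos.2 hΔ
  have ha2 : (1 / √n / √Δ) ^ 2 = 1 / (n * Δ) := by rw [div_pow, div_pow, hsn, hsΔ]; field_simp
  have hu : (fun (σ : Fin n → K) (q : SymIdx n) => x (σ q.1.1) * x (σ q.1.2) / √n / √Δ)
      = fun σ q => 1 / √n / √Δ * (x (σ q.1.1) * x (σ q.1.2)) := by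
    ext σ q; ring
  have hI := interpolation_bound (n := n) (w := fun σ => μ.real {σ}) (fun _ => measureReal_nonneg)
    (sum_measureReal_singleton μ) (fun σ i => x (σ i)) (a := 1 / √n / √Δ) (b := √(m / Δ))
    (c := n * m) (by rw [hsm, ha2]; field_simp)
  rw [integral_mix_pi_mul_log ν fun k => √(m / Δ) * x k, ha2] at hI
  have hE : ∑ σ, μ.real {σ} * ((∑ q : SymIdx n, (1 / √n / √Δ * (x (σ q.1.1) * x (σ q.1.2))) ^ 2) / 2)
      = 1 / (n * Δ) / 4 * (2 * n * (∫ k, x k ^ 4 ∂ν) + n * (n - 1) * (∫ k, x k ^ 2 ∂ν) ^ 2) := by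
    have h1 : ∀ σ : Fin n → K, (∑ q : SymIdx n, (1 / √n / √Δ * (x (σ q.1.1) * x (σ q.1.2))) ^ 2) / 2
        = 1 / (n * Δ) / 4 * ((∑ i, x (σ i) ^ 2) ^ 2 + ∑ i, (x (σ i) ^ 2) ^ 2) := fun σ => by
      have h2 := sum_symIdx_mul fun i => x (σ i) ^ 2
      simp only [mul_pow _ (_ * _), ha2, ← Finset.mul_sum, mul_pow (x _)]
      rw [h2]
      ring
    have h3 := integral_fintype (μ := μ) (f := fun σ => 1 / (n * Δ) / 4
      * ((∑ i, x (σ i) ^ 2) ^ 2 + ∑ i, (x (σ i) ^ 2) ^ 2)) Integrable.of_finite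
    simp only [smul_eq_mul] at h3
    simp only [h1, ← h3]
    rw [integral_const_mul, integral_add Integrable.of_finite Integrable.of_finite,
      integral_pi_sum_sq ν fun k => x k ^ 2, integral_finsetSum _ fun _ _ => Integrable.of_finite]
    simp only [integral_comp_eval (μ := fun _ : Fin n => ν) (f := fun k => (x k ^ 2) ^ 2)
      (measurable_of_finite _).aestronglyMeasurable, hμ]
    simp only [← pow_mul, Finset.sum_const, Finset.card_univ, Fintype.card_fin, nsmul_eq_mul]
    ring_nf
  rw [hu, (mutualInfoR_jointLaw μ _).2.2, hE, div_le_iff₀ hn0]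
  refine (sub_le_sub_left hI _).trans (le_of_eq ?_)
  field_simp
  ring

end DiscreteSignal

section SpikedMatrix

lemma exists_map_subtype_val {p : Measure ℝ} {s : Finset ℝ} (hs : p (↑s : Set ℝ)ᶜ = 0) :
    ∃ ν : Measure s, ν.map Subtype.val = p := by
  have hemb : MeasurableEmbedding (Subtype.val : s → ℝ) :=
    MeasurableEmbedding.subtype_coe s.measurableSet
  refine ⟨p.comap Subtype.val, ?_⟩
  rw [hemb.map_comap, Subtype.range_val]
  exact Measure.restrict_eq_self_of_ae_mem (mem_ae_iff.2 hs)

variable {s : Finset ℝ} (ν : Measure s) [IsProbabilityMeasure ν]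

lemma gaussJoint_eq_map_jointLaw {Δ : ℝ} (hΔ : 0 < Δ) (n : ℕ) :
    gaussJoint (ν.map Subtype.val) Δ n
      = (jointLaw (Measure.pi fun _ : Fin n => ν) fun σ (q : SymIdx n) =>
          (σ q.1.1 : ℝ) * σ q.1.2 / √n / √Δ).map
        (Prod.map (fun σ i => (σ i : ℝ)) (√Δ • ·)) := by
  have hpi : (Measure.pi fun _ : Fin n => ν.map (Subtype.val : s → ℝ))
      = (Measure.pi fun _ : Fin n => ν).map fun σ i => (σ i : ℝ) := by
    have : ∀ _ : Fin n, IsProbabilityMeasure (ν.map (Subtype.val : s → ℝ)) := fun _ =>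
      Measure.isProbabilityMeasure_map (by fun_prop)
    exact (Measure.pi_map_pi (μ := fun _ : Fin n => ν) (f := fun _ => Subtype.val)
      fun _ => by fun_prop).symm
  have hprod := Measure.map_prod_map (Measure.pi fun _ : Fin n => ν) (stdGauss (SymIdx n))
    (f := fun σ i => (σ i : ℝ)) (g := id) (by fun_prop) measurable_id
  rw [Measure.map_id] at hprod
  rw [gaussJoint, hpi, hprod, jointLaw, Measure.map_map (by fun_prop) (by fun_prop),
    Measure.map_map (by fun_prop) (measurable_channel fun (σ : Fin n → s) (q : SymIdx n) =>
      (σ q.1.1 : ℝ) * σ q.1.2 / √n / √Δ)]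
  congr 1
  ext w q
  · rfl
  · have := (sqrt_pos.2 hΔ).ne'
    simp only [Function.comp_apply, Prod.map, id, Pi.smul_apply, Pi.add_apply, smul_eq_mul]
    field_simp
    ring

lemma MI_eq_mutualInfoR_jointLaw {Δ : ℝ} (hΔ : 0 < Δ) (n : ℕ) :
    MI (ν.map Subtype.val) Δ n
      = mutualInfoR (jointLaw (Measure.pi fun _ : Fin n => ν) fun σ (q : SymIdx n) =>
          (σ q.1.1 : ℝ) * σ q.1.2 / √n / √Δ) := by
  rw [MI, gaussJoint_eq_map_jointLaw ν hΔ]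
  refine mutualInfoR_map (mutualInfoR_jointLaw _ _).1 ⟨fun σ τ h => ?_, by fun_prop,
    fun _ _ => (Set.toFinite _).measurableSet⟩
    (MeasurableEquiv.smul₀ (√Δ) (sqrt_pos.2 hΔ).ne').measurableEmbedding
  ext i
  exact congrFun h i

lemma Jf_eq_scalarLog {Δ m : ℝ} (hΔ : 0 < Δ) (hm : 0 ≤ m) (x t : ℝ) :
    Jf (ν.map Subtype.val) (m / Δ) (m * x / Δ + √(m / Δ) * t)
      = scalarLog ν (fun k => √(m / Δ) * k) (t + √(m / Δ) * x) := by
  have hsm := sq_sqrt (div_nonneg hm hΔ.le)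
  rw [Jf, integral_map (by fun_prop) (by fun_prop), integral_fintype Integrable.of_finite,
    scalarLog, mix]
  congr 1
  refine Finset.sum_congr rfl fun k _ => ?_
  rw [smul_eq_mul, tilt, Fintype.sum_unique]
  congr 2
  linear_combination (-(k : ℝ) * x + (k : ℝ) ^ 2 / 2) * hsm

lemma iB_eq_scalarLog {Δ m : ℝ} (hΔ : 0 < Δ) (hm : 0 ≤ m) :
    iB (ν.map Subtype.val) Δ m
      = (m ^ 2 + (∫ k : s, (k : ℝ) ^ 2 ∂ν) ^ 2) / (4 * Δ)
        - ∫ w, scalarLog ν (fun k => √(m / Δ) * k) (w.2 + √(m / Δ) * w.1)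
          ∂(ν.prod (gaussianReal 0 1)) := by
  have hemb : MeasurableEmbedding (Subtype.val : s → ℝ) :=
    MeasurableEmbedding.subtype_coe s.measurableSet
  have hprod := Measure.map_prod_map ν (gaussianReal 0 1) hemb.measurable measurable_id
  rw [Measure.map_id] at hprod
  simp only [iB, Jf_eq_scalarLog ν hΔ hm]
  rw [hprod, (hemb.prodMap MeasurableEmbedding.id).integral_map, hemb.integral_map]
  rfl

end SpikedMatrix

/-- **Upper bound** : for every `m ≥ 0` and every `n ≥ 1`,
`I(x*;Y)/n ≤ i_B(m) + (2 E_p[X⁴] − (E_p[X²])²)/(4nΔ)`; in particular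
`limsup_{n→∞} I(x*;Y)/n ≤ i_B(m)`. -/
theorem upper_bound (p : Measure ℝ) [IsProbabilityMeasure p]
    (hsupp : ∃ s : Finset ℝ, p (↑s : Set ℝ)ᶜ = 0)
    (Δ : ℝ) (hΔ : 0 < Δ) (m : ℝ) (hm : 0 ≤ m) :
    (∀ n : ℕ, 1 ≤ n →
      MI p Δ n / n ≤ iB p Δ m
        + (2 * (∫ x, x ^ 4 ∂p) - (∫ x, x ^ 2 ∂p) ^ 2) / (4 * n * Δ)) ∧
    limsup (fun n : ℕ => MI p Δ n / n) atTop ≤ iB p Δ m := by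
  obtain ⟨s, hs⟩ := hsupp
  obtain ⟨ν, rfl⟩ := exists_map_subtype_val hs
  have : IsProbabilityMeasure ν := Measure.isProbabilityMeasure_of_map (μ := ν) Subtype.val
  have hemb : MeasurableEmbedding (Subtype.val : s → ℝ) :=
    MeasurableEmbedding.subtype_coe s.measurableSet
  have bound : ∀ n : ℕ, 1 ≤ n → MI (ν.map Subtype.val) Δ n / n ≤ iB (ν.map Subtype.val) Δ m
      + (2 * (∫ x, x ^ 4 ∂(ν.map Subtype.val)) - (∫ x, x ^ 2 ∂(ν.map Subtype.val)) ^ 2)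
        / (4 * n * Δ) := fun n hn => by
    rw [MI_eq_mutualInfoR_jointLaw ν hΔ, iB_eq_scalarLog ν hΔ hm, hemb.integral_map,
      hemb.integral_map]
    exact mutualInfoR_spiked_le ν (fun k : s => (k : ℝ)) hΔ hm hn
  refine ⟨bound, ?_⟩
  set C := 2 * (∫ x, x ^ 4 ∂(ν.map Subtype.val)) - (∫ x, x ^ 2 ∂(ν.map Subtype.val)) ^ 2
  have hlim : Tendsto (fun n : ℕ => iB (ν.map Subtype.val) Δ m + C / (4 * n * Δ)) atTop
      (nhds (iB (ν.map Subtype.val) Δ m)) := by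
    have h := (tendsto_const_div_atTop_nhds_zero_nat (C / (4 * Δ))).const_add
      (iB (ν.map Subtype.val) Δ m)
    rw [add_zero] at h
    refine h.congr fun n => ?_
    rw [div_div, mul_right_comm]
  have hnonneg : ∀ n : ℕ, 0 ≤ MI (ν.map Subtype.val) Δ n / n := fun n => by
    rw [MI_eq_mutualInfoR_jointLaw ν hΔ]
    exact div_nonneg (mutualInfoR_jointLaw _ _).2.1 n.cast_nonneg
  rw [← hlim.limsup_eq]
  refine limsup_le_limsup ?_ (isCoboundedUnder_le_of_le atTop hnonneg)
    hlim.isBoundedUnder_le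
  filter_upwards [eventually_ge_atTop 1] with n hn using bound n hn
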